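/- arXiv:2410.21268 — 6 statements merged into one kernel-verified Lean document; each statement's English description precedes it below -/
import Mathlib

section
/- Let B, A, C be finite types with a bijection p : B × A → C and a function f : B × A → ℤ/2ℤ. Define the permutation matrix P ∈ Matrix C (B×A) ℂ by P_{c,(b,a)} = 1 if c = p(b,a) and 0 otherwise; the diagonal sign matrix F ∈ Matrix (B×A) (B×A) ℂ with diagonal entries (−1)^{f(b,a)}; and for each a ∈ A the matrix O_a ∈ Matrix C B ℂ with (O_a)_{c,b} = (−1)^{f(b,a)} if c = p(b,a) and 0 otherwise. Then for every matrix u ∈ Matrix B B ℂ: P·F·(u ⊗ I_A)·F·Pᵀ = Σ_{a∈A} O_a·u·O_aᴴ, where u ⊗ I_A denotes the Kronecker product of u with the identity matrix indexed by A (a matrix indexed by B×A). -/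
open Matrix
open scoped Kronecker

/-- Multiplying `u ⊗ I` by block matrices on both sides sums over the blocks. -/
theorem mul_kronecker_one_mul_eq_sum {R l m n k : Type*} [CommSemiring R]
    [Fintype n] [Fintype k] [DecidableEq k]
    (V : Matrix l (n × k) R) (W : Matrix (n × k) m R) (u : Matrix n n R) :
    V * (u ⊗ₖ (1 : Matrix k k R)) * W =
      ∑ a, V.submatrix id (·, a) * u * W.submatrix (·, a) id := by
  ext i j
  simp only [Matrix.sum_apply, mul_apply, kroneckerMap_apply, one_apply, submatrix_apply, id,
    Fintype.sum_prod_type, mul_ite, mul_one, mul_zero, Finset.sum_ite_eq', Finset.mem_univ,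
    if_true]
  rw [Finset.sum_comm]

/-- With `P` the permutation matrix of the bijection `p : B × A ≃ C`,
`F` the diagonal sign matrix of `f : B × A → ℤ/2`, and `O a` the subset-phase isometry
`(O a)_{c,b} = (−1)^{f(b,a)} [c = p(b,a)]`, one has
`P · F · (u ⊗ I_A) · F · Pᵀ = Σ_a (O a) · u · (O a)ᴴ` for every `u : Matrix B B ℂ`. -/
theorem stmt2 (B A C : Type) [Fintype B] [Fintype A] [Fintype C]
    [DecidableEq B] [DecidableEq A] [DecidableEq C]
    (p : B × A ≃ C) (f : B × A → ZMod 2)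
    (P : Matrix C (B × A) ℂ)
    (hP : ∀ c ba, P c ba = if c = p ba then 1 else 0)
    (F : Matrix (B × A) (B × A) ℂ)
    (hF : F = Matrix.diagonal fun ba => if f ba = 0 then (1 : ℂ) else -1)
    (O : A → Matrix C B ℂ)
    (hO : ∀ a c b, O a c b =
      if c = p (b, a) then (if f (b, a) = 0 then (1 : ℂ) else -1) else 0)
    (u : Matrix B B ℂ) :
    P * F * (u ⊗ₖ (1 : Matrix A A ℂ)) * F * Pᵀ = ∑ a : A, O a * u * (O a)ᴴ := by
  have hO' (a : A) : O a = (P * F).submatrix id (·, a) := by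
    ext c b
    simp only [hO, hF, hP, submatrix_apply, id, mul_diagonal, ite_mul, one_mul, zero_mul]
  have hPF : F * Pᵀ = (P * F)ᴴ := by
    ext x c
    simp only [hF, diagonal_mul, conjTranspose_apply, mul_diagonal, hP, transpose_apply]
    split_ifs <;> simp
  rw [Matrix.mul_assoc _ F, hPF, mul_kronecker_one_mul_eq_sum]
  simp only [hO', conjTranspose_submatrix]
end

section
/- Let n > k ≥ 1 be natural numbers, B = {0,1}^k, A = {0,1}^{n−k}, V = {0,1}^n. Fix a position z ∈ {1,…,n} and an element b₀ ∈ B, and let e_z ∈ V denote the n-bit string with a single 1 at position z. For a uniformly random bijection p : B × A → V, the expected value of the number of a ∈ A such that p(b₀,a) ⊕ e_z belongs to the set p(B × {a}) equals 2^{n−k}·(2^k − 1)/(2^n − 1). -/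
open Finset

/-- Among all bijections `p : X ≃ Y`, a fraction `1 / (|X| - 1)` satisfies `p x' = f (p x)`, where
`x' ≠ x` are given points and `f` has no fixed point. -/
theorem card_sub_one_mul_card_filter_equiv_apply_eq {X Y : Type*} [Fintype X] [DecidableEq X]
    [Fintype Y] [DecidableEq Y] (f : Y → Y) (hf : ∀ y, f y ≠ y) {x x' : X} (h : x' ≠ x) :
    (Fintype.card X - 1) * #{p : X ≃ Y | p x' = f (p x)} = Fintype.card (X ≃ Y) := by
  have invariant : ∀ w ∈ univ.erase x,
      #{p : X ≃ Y | p w = f (p x)} = #{p : X ≃ Y | p x' = f (p x)} := by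
    intro w hw
    have hwx : w ≠ x := ne_of_mem_erase hw
    refine card_equiv (Equiv.equivCongr (Equiv.swap w x') (Equiv.refl Y)) fun p ↦ ?_
    simp [Equiv.swap_apply_of_ne_of_ne hwx.symm h.symm]
  have fiber := card_eq_sum_card_fiberwise (f := fun p : X ≃ Y ↦ p.symm (f (p x)))
    (s := univ) (t := univ.erase x) (by
      intro p _
      simpa [Equiv.symm_apply_eq] using hf (p x))
  rw [← card_univ (α := X ≃ Y), fiber, ← card_univ (α := X), ← card_erase_of_mem (mem_univ x),
    ← smul_eq_mul, ← sum_const, ← sum_congr rfl invariant]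
  refine sum_congr rfl fun w _ ↦ ?_
  congr 1
  ext p
  simp only [mem_filter_univ, Equiv.symm_apply_eq]
  exact eq_comm

/-- Summed over all bijections `p : B × A ≃ Y`, the number of `a` such that `f (p (b₀, a))` lies in
the block `p (B × {a})`, for `f` without fixed points. -/
theorem card_sub_one_mul_sum_card_filter_exists {A B Y : Type*} [Fintype A] [DecidableEq A]
    [Fintype B] [DecidableEq B] [Fintype Y] [DecidableEq Y] (f : Y → Y) (hf : ∀ y, f y ≠ y)
    (b₀ : B) :
    (Fintype.card (B × A) - 1) *
        ∑ p : B × A ≃ Y, #{a : A | ∃ b, p (b, a) = f (p (b₀, a))} =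
      Fintype.card A * (Fintype.card B - 1) * Fintype.card (B × A ≃ Y) := by
  have pairs (p : B × A ≃ Y) : #{a : A | ∃ b, p (b, a) = f (p (b₀, a))} =
      ∑ a : A, ∑ b ∈ univ.erase b₀, if p (b, a) = f (p (b₀, a)) then 1 else 0 := by
    rw [card_filter]
    refine sum_congr rfl fun a _ ↦ ?_
    split_ifs with h
    · obtain ⟨b, hb⟩ := h
      have hne : b ≠ b₀ := by
        rintro rfl
        exact hf _ hb.symm
      rw [sum_eq_single_of_mem b (by simp [hne]), if_pos hb]
      intro c _ hc
      refine if_neg fun hc' ↦ hc ?_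
      simpa using p.injective (hc'.trans hb.symm)
    · exact (sum_eq_zero fun b _ ↦ if_neg fun hb ↦ h ⟨b, hb⟩).symm
  simp_rw [pairs]
  rw [sum_comm, mul_sum]
  have inner (a : A) : (Fintype.card (B × A) - 1) *
      ∑ p : B × A ≃ Y, ∑ b ∈ univ.erase b₀, (if p (b, a) = f (p (b₀, a)) then 1 else 0) =
      (Fintype.card B - 1) * Fintype.card (B × A ≃ Y) := by
    rw [sum_comm, mul_sum, sum_congr rfl (g := fun _ ↦ Fintype.card (B × A ≃ Y))]
    · simp [card_erase_of_mem]
    · intro b hb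
      rw [← card_filter]
      exact card_sub_one_mul_card_filter_equiv_apply_eq f hf (by simpa using ne_of_mem_erase hb)
  simp_rw [inner]
  simp [mul_assoc]

/-- For a uniformly random bijection
`p : {0,1}^k × {0,1}^{n−k} ≃ {0,1}^n`, the expected number of seeds `a` such that
`p(b₀,a) ⊕ e_z` lies in the block `p(B × {a})` equals `2^{n−k}(2^k − 1)/(2^n − 1)`. -/
theorem stmt6 (n k : ℕ) (hk : 1 ≤ k) (hkn : k < n) (z : Fin n)
    (b₀ : Fin k → ZMod 2) :
    (Fintype.card (((Fin k → ZMod 2) × (Fin (n - k) → ZMod 2)) ≃ (Fin n → ZMod 2)) : ℝ)⁻¹ *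
        ∑ p : ((Fin k → ZMod 2) × (Fin (n - k) → ZMod 2)) ≃ (Fin n → ZMod 2),
          ((Finset.univ.filter fun a : Fin (n - k) → ZMod 2 =>
              ∃ b : Fin k → ZMod 2,
                p (b, a) = p (b₀, a) + Pi.single z 1).card : ℝ) =
      2 ^ (n - k) * ((2 : ℝ) ^ k - 1) / ((2 : ℝ) ^ n - 1) := by
  have shift_ne (y : Fin n → ZMod 2) : y + Pi.single z 1 ≠ y := by simp
  have card_dom : Fintype.card ((Fin k → ZMod 2) × (Fin (n - k) → ZMod 2)) = 2 ^ n := by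
    simp [ZMod.card, ← pow_add, Nat.add_sub_cancel' hkn.le]
  have card_pos : 0 < Fintype.card
      (((Fin k → ZMod 2) × (Fin (n - k) → ZMod 2)) ≃ (Fin n → ZMod 2)) :=
    Fintype.card_pos_iff.mpr ⟨Fintype.equivOfCardEq (by rw [card_dom]; simp [ZMod.card])⟩
  have count := congrArg (Nat.cast (R := ℝ))
    (card_sub_one_mul_sum_card_filter_exists (A := Fin (n - k) → ZMod 2)
      (· + Pi.single z 1) shift_ne b₀)
  rw [card_dom] at count
  simp only [Fintype.card_fun, Fintype.card_fin, ZMod.card] at count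
  push_cast [Nat.one_le_two_pow] at count
  have denom_pos : (0 : ℝ) < 2 ^ n - 1 := sub_pos.mpr (one_lt_pow₀ one_lt_two (by omega))
  rw [inv_mul_eq_div, div_eq_div_iff (by positivity) denom_pos.ne', mul_comm]
  convert count
end

section
/- Let n > k ≥ 1 be natural numbers, B = {0,1}^k, A = {0,1}^{n−k}, V = {0,1}^n. Fix a position z ∈ {1,…,n} and b₀ ∈ B, and let e_z ∈ V be the n-bit string with a single 1 at position z. For a uniformly random bijection p : B × A → V and any real ε > 0, the probability that the number of a ∈ A with p(b₀,a) ⊕ e_z ∈ p(B × {a}) is at least 2^{(1+ε)k} is at most 2^{−εk}. -/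
open Finset

/-- For fixed distinct points `x` and `y`, the bijections `p` with `p y = w (p x)` make up at most
a fraction `1 / (|α| - 1)` of all bijections. -/
lemma card_sub_one_mul_card_equiv_apply_eq_le {α β : Type*} [Fintype α] [Fintype β]
    [DecidableEq α] [DecidableEq β] (w : β → β) {x y : α} (hxy : y ≠ x) :
    (Fintype.card α - 1) * #{p : α ≃ β | p y = w (p x)} ≤ Fintype.card (α ≃ β) := by
  have hswap : ∀ y' ∈ univ.erase x,
      #{p : α ≃ β | p y' = w (p x)} = #{p : α ≃ β | p y = w (p x)} := by
    intro y' hy'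
    have hy'x : y' ≠ x := ne_of_mem_erase hy'
    refine card_bij' (fun p _ => (Equiv.swap y y').trans p) (fun p _ => (Equiv.swap y y').trans p)
      ?_ ?_ ?_ ?_
    · intro p hp
      simpa [Equiv.swap_apply_of_ne_of_ne hxy.symm hy'x.symm] using hp
    · intro p hp
      simpa [Equiv.swap_apply_of_ne_of_ne hxy.symm hy'x.symm] using hp
    · intro p _
      ext t
      simp
    · intro p _
      ext t
      simp
  calc (Fintype.card α - 1) * #{p : α ≃ β | p y = w (p x)}
      = ∑ y' ∈ univ.erase x, #{p : α ≃ β | p y' = w (p x)} := by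
        rw [sum_congr rfl hswap, sum_const, card_erase_of_mem (mem_univ x), card_univ, smul_eq_mul]
    _ = #((univ.erase x).biUnion fun y' => {p : α ≃ β | p y' = w (p x)}) := by
        refine (card_biUnion fun y₁ _ y₂ _ hne => ?_).symm
        refine disjoint_left.mpr ?_
        intro p h₁ h₂
        simp only [mem_filter, mem_univ, true_and] at h₁ h₂
        exact hne (p.injective (h₁.trans h₂.symm))
    _ ≤ Fintype.card (α ≃ β) := card_le_univ _

/-- If `w` has no fixed point, then for a uniformly random bijection `p : B × A ≃ V` the expected
number of `a` with `w (p (b₀, a)) ∈ p (B × {a})` is at most one. -/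
lemma sum_card_filter_exists_apply_eq_le {A B V : Type*} [Fintype A] [Fintype B] [Fintype V]
    [DecidableEq A] [DecidableEq B] [DecidableEq V]
    (b₀ : B) (w : V → V) (hw : ∀ v, w v ≠ v) (hAB : 1 < Fintype.card (B × A)) :
    ∑ p : (B × A) ≃ V, #{a : A | ∃ b : B, p (b, a) = w (p (b₀, a))} ≤
      Fintype.card ((B × A) ≃ V) := by
  have hpos : 0 < Fintype.card (B × A) - 1 := by omega
  refine Nat.le_of_mul_le_mul_left ?_ hpos
  have hA : 1 ≤ Fintype.card A := by
    by_contra! h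
    simp [Nat.lt_one_iff.mp h] at hAB
  calc (Fintype.card (B × A) - 1) *
        ∑ p : (B × A) ≃ V, #{a : A | ∃ b : B, p (b, a) = w (p (b₀, a))}
      = (Fintype.card (B × A) - 1) *
        ∑ a : A, #{p : (B × A) ≃ V | ∃ b : B, p (b, a) = w (p (b₀, a))} := by
        simp only [card_filter]
        rw [sum_comm]
    _ ≤ (Fintype.card (B × A) - 1) *
        ∑ a : A, ∑ b ∈ univ.erase b₀, #{p : (B × A) ≃ V | p (b, a) = w (p (b₀, a))} := by
        gcongr with a
        refine (card_le_card ?_).trans card_biUnion_le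
        intro p hp
        obtain ⟨b, hb⟩ := (mem_filter.mp hp).2
        simp only [mem_biUnion, mem_erase, mem_filter, mem_univ, true_and, and_true]
        refine ⟨b, ?_, hb⟩
        rintro rfl
        exact hw _ hb.symm
    _ = ∑ a : A, ∑ b ∈ univ.erase b₀,
        (Fintype.card (B × A) - 1) * #{p : (B × A) ≃ V | p (b, a) = w (p (b₀, a))} := by
        simp only [mul_sum]
    _ ≤ ∑ _a : A, ∑ _b ∈ univ.erase b₀, Fintype.card ((B × A) ≃ V) := by
        refine sum_le_sum fun a _ => sum_le_sum fun b hb => ?_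
        refine card_sub_one_mul_card_equiv_apply_eq_le w ?_
        simpa using ne_of_mem_erase hb
    _ = (Fintype.card A * (Fintype.card B - 1)) * Fintype.card ((B × A) ≃ V) := by
        simp only [sum_const, card_erase_of_mem (mem_univ b₀), card_univ, smul_eq_mul, mul_assoc]
    _ ≤ (Fintype.card (B × A) - 1) * Fintype.card ((B × A) ≃ V) := by
        refine Nat.mul_le_mul_right _ ?_
        rw [Fintype.card_prod, Nat.mul_sub, mul_one, mul_comm]
        exact Nat.sub_le_sub_left hA _

/-- Markov's inequality for the uniform distribution on a finite type. -/
lemma card_filter_le_div_card_le {ι : Type*} [Fintype ι] (f : ι → ℕ) {t : ℝ}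
    [DecidablePred fun i => t ≤ (f i : ℝ)] (ht : 0 < t) (hf : ∑ i, f i ≤ Fintype.card ι) :
    (#{i | t ≤ (f i : ℝ)} : ℝ) / Fintype.card ι ≤ t⁻¹ := by
  refine div_le_of_le_mul₀ (Nat.cast_nonneg _) (inv_nonneg.mpr ht.le) ?_
  rw [inv_mul_eq_div, le_div_iff₀ ht]
  calc (#{i | t ≤ (f i : ℝ)} : ℝ) * t = ∑ i with t ≤ (f i : ℝ), t := by simp
    _ ≤ ∑ i with t ≤ (f i : ℝ), (f i : ℝ) := sum_le_sum fun i hi => (mem_filter.mp hi).2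
    _ ≤ ∑ i, (f i : ℝ) := sum_le_univ_sum_of_nonneg fun i => Nat.cast_nonneg _
    _ ≤ Fintype.card ι := mod_cast hf

/- **Statement 7.** For a uniformly random bijection
`p : {0,1}^k × {0,1}^{n−k} ≃ {0,1}^n` and any `ε > 0`, the probability that the
number of seeds `a` with `p(b₀,a) ⊕ e_z ∈ p(B × {a})` is at least `2^{(1+ε)k}`
is at most `2^{−εk}`. (Powers `2^{(1+ε)k}` and `2^{−εk}` are real powers.) -/
open Classical in
theorem stmt7 (n k : ℕ) (hk : 1 ≤ k) (hkn : k < n) (z : Fin n)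
    (b₀ : Fin k → ZMod 2) (ε : ℝ) (hε : 0 < ε) :
    ((Finset.univ.filter fun
        p : ((Fin k → ZMod 2) × (Fin (n - k) → ZMod 2)) ≃ (Fin n → ZMod 2) =>
          (2 : ℝ) ^ ((1 + ε) * k) ≤
            ((Finset.univ.filter fun a : Fin (n - k) → ZMod 2 =>
              ∃ b : Fin k → ZMod 2,
                p (b, a) = p (b₀, a) + Pi.single z 1).card : ℝ)).card : ℝ) /
      (Fintype.card (((Fin k → ZMod 2) × (Fin (n - k) → ZMod 2)) ≃ (Fin n → ZMod 2)) : ℝ) ≤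
    (2 : ℝ) ^ (-(ε * k)) := by
  have hcard : 1 < Fintype.card ((Fin k → ZMod 2) × (Fin (n - k) → ZMod 2)) := by
    rw [Fintype.card_prod, Fintype.card_fun, Fintype.card_fun]
    simp only [ZMod.card, Fintype.card_fin, ← pow_add]
    exact Nat.one_lt_two_pow (by omega)
  have hw : ∀ v : Fin n → ZMod 2, v + Pi.single z 1 ≠ v := by simp
  have hmean := sum_card_filter_exists_apply_eq_le b₀
    (fun v : Fin n → ZMod 2 => v + Pi.single z 1) hw hcard
  have ht : (0 : ℝ) < 2 ^ ((1 + ε) * k) := by positivity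
  calc _ ≤ ((2 : ℝ) ^ ((1 + ε) * k))⁻¹ := by
        convert card_filter_le_div_card_le _ ht (by convert hmean) using 1
    _ = (2 : ℝ) ^ (-((1 + ε) * k)) := (Real.rpow_neg zero_le_two _).symm
    _ ≤ (2 : ℝ) ^ (-(ε * k)) := by
        refine Real.rpow_le_rpow_of_exponent_le one_le_two ?_
        nlinarith [(Nat.cast_nonneg k : (0 : ℝ) ≤ k)]
end

section
/- Let n > k ≥ 1 be natural numbers and fix a position z ∈ {1,…,n}; let e_z ∈ {0,1}^n be the n-bit string with a single 1 at position z. For a uniformly random subset S of {0,1}^n of cardinality 2^k, the probability that no element x ∈ S satisfies x ⊕ e_z ∈ S equals ∏_{j=1}^{2^k} (1 − (j−1)/(2^n − j + 1)). -/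
open Finset

section PairFree

variable {α : Type*} [Fintype α] [DecidableEq α]

/-- The `m`-element subsets of `α` that contain no pair `x, σ x`. -/
def pairFreeSets (σ : α → α) (m : ℕ) : Finset (Finset α) :=
  (powersetCard m univ).filter fun S => ∀ x ∈ S, σ x ∉ S

lemma mem_pairFreeSets {σ : α → α} {m : ℕ} {S : Finset α} :
    S ∈ pairFreeSets σ m ↔ #S = m ∧ ∀ x ∈ S, σ x ∉ S := by
  simp [pairFreeSets]

lemma card_compl_union_image_add {σ : α → α} (hσ : Function.Involutive σ) {m : ℕ}
    {S : Finset α} (hS : S ∈ pairFreeSets σ m) :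
    #(S ∪ S.image σ)ᶜ + 2 * m = Fintype.card α := by
  obtain ⟨hm, hfree⟩ := mem_pairFreeSets.1 hS
  have hdisj : Disjoint S (S.image σ) := by
    rw [disjoint_right]
    intro y hy
    obtain ⟨x, hx, rfl⟩ := mem_image.1 hy
    exact hfree x hx
  have hcard : #(S ∪ S.image σ) = 2 * m := by
    rw [card_union_of_disjoint hdisj, card_image_of_injective _ hσ.injective, hm, two_mul]
  rw [← hcard, card_compl_add_card]

/-- Counting pairs of a pair-free set and one of its elements in two ways. -/
lemma card_pairFreeSets_succ_mul {σ : α → α} (hσ : Function.Involutive σ)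
    (hfix : ∀ x, σ x ≠ x) (m : ℕ) :
    #(pairFreeSets σ (m + 1)) * (m + 1) = ∑ S ∈ pairFreeSets σ m, #(S ∪ S.image σ)ᶜ := by
  have hsum : #(pairFreeSets σ (m + 1)) * (m + 1) = ∑ T ∈ pairFreeSets σ (m + 1), #T := by
    rw [sum_congr rfl fun T hT => (mem_pairFreeSets.1 hT).1, sum_const, smul_eq_mul]
  rw [hsum, ← card_sigma, ← card_sigma]
  refine card_nbij' (fun p => ⟨p.1.erase p.2, p.2⟩) (fun p => ⟨insert p.2 p.1, p.2⟩) ?_ ?_ ?_ ?_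
  · rintro ⟨T, x⟩ h
    simp only [coe_sigma, Set.mem_sigma_iff, mem_coe, mem_pairFreeSets] at h ⊢
    obtain ⟨⟨hT, hfree⟩, hx⟩ := h
    refine ⟨⟨by rw [card_erase_of_mem hx, hT, Nat.add_sub_cancel], fun y hy hy' =>
      hfree y (mem_of_mem_erase hy) (mem_of_mem_erase hy')⟩, ?_⟩
    simp only [mem_compl, mem_union, mem_image, mem_erase, not_or, not_exists]
    refine ⟨fun h => h.1 rfl, ?_⟩
    rintro y ⟨⟨-, hy⟩, rfl⟩
    exact hfree y hy hx
  · rintro ⟨S, x⟩ h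
    simp only [coe_sigma, Set.mem_sigma_iff, mem_coe, mem_pairFreeSets, mem_compl, mem_union,
      mem_image, not_or, not_exists, not_and] at h ⊢
    obtain ⟨⟨hS, hfree⟩, hx, hx'⟩ := h
    refine ⟨⟨by rw [card_insert_of_notMem hx, hS], fun y hy hy' => ?_⟩, mem_insert_self _ _⟩
    rcases mem_insert.1 hy with rfl | hy <;> rcases mem_insert.1 hy' with h | h
    · exact hfix _ h
    · exact hx' _ h (hσ _)
    · exact hx' _ hy h
    · exact hfree _ hy h
  · rintro ⟨T, x⟩ h
    simp only [coe_sigma, Set.mem_sigma_iff, mem_coe] at h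
    simp [insert_erase h.2]
  · rintro ⟨S, x⟩ h
    simp only [coe_sigma, Set.mem_sigma_iff, mem_coe, mem_compl, mem_union, not_or] at h
    simp [erase_insert h.2.1]

lemma card_pairFreeSets_succ {σ : α → α} (hσ : Function.Involutive σ)
    (hfix : ∀ x, σ x ≠ x) (m : ℕ) :
    (#(pairFreeSets σ (m + 1)) : ℝ) * (m + 1) =
      #(pairFreeSets σ m) * ((Fintype.card α : ℝ) - 2 * m) := by
  have h := card_pairFreeSets_succ_mul hσ hfix m
  have hS : ∀ S ∈ pairFreeSets σ m,
      ((#(S ∪ S.image σ)ᶜ : ℕ) : ℝ) = (Fintype.card α : ℝ) - 2 * m := fun S hS => by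
    rw [← card_compl_union_image_add hσ hS]
    push_cast
    ring
  rw [← nsmul_eq_mul (#(pairFreeSets σ m)), ← sum_const, ← sum_congr rfl hS]
  exact_mod_cast h

/-- The proportion of pair-free sets among all `m`-element sets. -/
lemma card_pairFreeSets_div_choose {σ : α → α} (hσ : Function.Involutive σ)
    (hfix : ∀ x, σ x ≠ x) {m : ℕ} (hm : m ≤ Fintype.card α) :
    (#(pairFreeSets σ m) : ℝ) / ((Fintype.card α).choose m : ℝ) =
      ∏ j ∈ Icc 1 m, (1 - ((j : ℝ) - 1) / ((Fintype.card α : ℝ) - j + 1)) := by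
  induction m with
  | zero => simp [pairFreeSets, filter_singleton]
  | succ m ih =>
    rw [prod_Icc_succ_top (by omega), ← ih (by omega)]
    have hrec := card_pairFreeSets_succ hσ hfix m
    have hlt : (m : ℝ) < Fintype.card α := by exact_mod_cast hm
    have hsub : (Fintype.card α : ℝ) - m ≠ 0 := by linarith
    have hchoose : ((Fintype.card α).choose (m + 1) : ℝ) * (m + 1) =
        (Fintype.card α).choose m * ((Fintype.card α : ℝ) - m) := by
      rw [← Nat.cast_sub (by omega)]
      exact_mod_cast Nat.choose_succ_right_eq _ m
    have hm0 : (m : ℝ) + 1 ≠ 0 := by positivity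
    have hfactor : 1 - (((m + 1 : ℕ) : ℝ) - 1) / ((Fintype.card α : ℝ) - (m + 1 : ℕ) + 1) =
        ((Fintype.card α : ℝ) - 2 * m) / ((Fintype.card α : ℝ) - m) := by
      push_cast
      rw [add_sub_cancel_right, sub_add_eq_sub_sub, sub_add_cancel, one_sub_div hsub]
      ring
    rw [hfactor, div_mul_div_comm, ← hrec, ← hchoose, mul_div_mul_right _ _ hm0]

end PairFree

/-- For a uniformly random subset `S ⊆ {0,1}^n` of cardinality `2^k`,
the probability that `S` contains no bit-flip pair at position `z` (no `x ∈ S` with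
`x ⊕ e_z ∈ S`) equals `∏_{j=1}^{2^k} (1 − (j−1)/(2^n − j + 1))`. -/
theorem stmt8 (n k : ℕ) (hk : 1 ≤ k) (hkn : k < n) (z : Fin n) :
    (((Finset.powersetCard (2 ^ k) (Finset.univ : Finset (Fin n → ZMod 2))).filter
        fun S => ∀ x ∈ S, x + Pi.single z 1 ∉ S).card : ℝ) /
      ((Finset.powersetCard (2 ^ k) (Finset.univ : Finset (Fin n → ZMod 2))).card : ℝ) =
    ∏ j ∈ Finset.Icc (1 : ℕ) (2 ^ k),
      (1 - ((j : ℝ) - 1) / ((2 : ℝ) ^ n - (j : ℝ) + 1)) := by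
  have hcard : Fintype.card (Fin n → ZMod 2) = 2 ^ n := by simp [ZMod.card]
  have hσ : Function.Involutive fun x : Fin n → ZMod 2 => x + Pi.single z 1 := fun x => by
    simp only [add_assoc, CharTwo.add_self_eq_zero, add_zero, ← Pi.single_add, Pi.single_zero]
  have hfix : ∀ x : Fin n → ZMod 2, x + Pi.single z 1 ≠ x := fun x h => by
    simp at h
  have h := card_pairFreeSets_div_choose hσ hfix (m := 2 ^ k)
    (hcard ▸ Nat.pow_le_pow_right two_pos hkn.le)
  rw [card_powersetCard, card_univ]
  rw [hcard] at h ⊢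
  push_cast at h
  exact h
end

section
/- Let n > k ≥ 1 be natural numbers, let B be a finite type with |B| = 2^k, and let φ : B → ℤ/2ℤ be an arbitrary function. Then the average over all functions f : B → ℤ/2ℤ of the fourth power of c(f) := 2^{−(n+k)/2}·Σ_{b∈B} (−1)^{f(b)+φ(b)} equals (3·2^{2k} − 2^{k+1})·2^{−2(n+k)}; in particular it is strictly less than 3·2^{−2n}. -/
open Finset

/-- The sign `(−1)^m` of `m : ℤ/2`. -/
def zmodTwoSign (m : ZMod 2) : ℝ := if m = 0 then 1 else -1

lemma zmodTwoSign_add_one (m : ZMod 2) : zmodTwoSign (m + 1) = -zmodTwoSign m := by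
  have h : m + 1 = 0 ↔ m ≠ 0 := by
    revert m
    decide
  by_cases hm : m = 0 <;> simp [zmodTwoSign, h, hm]

lemma zmodTwoSign_sq (m : ZMod 2) : zmodTwoSign m ^ 2 = 1 := by
  unfold zmodTwoSign
  split_ifs <;> norm_num

section SignSums

variable {B : Type*} [Fintype B] [DecidableEq B]

/-- Flipping the sign at a point outside `s` preserves the moments of the sign sum. -/
lemma sum_add_zmodTwoSign_pow {s : Finset B} {a : B} (ha : a ∉ s) (m : ℕ) :
    ∑ f : B → ZMod 2, (zmodTwoSign (f a) + ∑ b ∈ s, zmodTwoSign (f b)) ^ m =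
      ∑ f : B → ZMod 2, (-zmodTwoSign (f a) + ∑ b ∈ s, zmodTwoSign (f b)) ^ m := by
  rw [← Equiv.sum_comp (Equiv.addRight (Pi.single a (1 : ZMod 2)))]
  refine sum_congr rfl fun f _ => ?_
  have hs : ∀ b ∈ s, zmodTwoSign ((f + Pi.single a (1 : ZMod 2) : B → ZMod 2) b) =
      zmodTwoSign (f b) := by
    intro b hb
    have hba : b ≠ a := fun h => ha (h ▸ hb)
    simp [hba]
  simp only [Equiv.coe_addRight]
  rw [sum_congr rfl hs]
  simp [zmodTwoSign_add_one]

lemma sum_zmodTwoSign_pow_two (s : Finset B) :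
    ∑ f : B → ZMod 2, (∑ b ∈ s, zmodTwoSign (f b)) ^ 2 =
      (#s : ℝ) * 2 ^ Fintype.card B := by
  induction s using Finset.induction_on with
  | empty => simp
  | insert a s ha ih =>
    simp only [sum_insert ha, card_insert_of_notMem ha]
    have key : ∑ f : B → ZMod 2, ((zmodTwoSign (f a) + ∑ b ∈ s, zmodTwoSign (f b)) ^ 2 +
        (-zmodTwoSign (f a) + ∑ b ∈ s, zmodTwoSign (f b)) ^ 2) =
        ∑ f : B → ZMod 2, (2 * (∑ b ∈ s, zmodTwoSign (f b)) ^ 2 + 2) :=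
      sum_congr rfl fun f _ => by linear_combination 2 * zmodTwoSign_sq (f a)
    rw [sum_add_distrib, ← sum_add_zmodTwoSign_pow ha, sum_add_distrib, ← mul_sum, ih] at key
    simp at key
    push_cast
    linarith

lemma sum_zmodTwoSign_pow_four (s : Finset B) :
    ∑ f : B → ZMod 2, (∑ b ∈ s, zmodTwoSign (f b)) ^ 4 =
      (3 * (#s : ℝ) ^ 2 - 2 * #s) * 2 ^ Fintype.card B := by
  induction s using Finset.induction_on with
  | empty => simp
  | insert a s ha ih =>
    simp only [sum_insert ha, card_insert_of_notMem ha]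
    have key : ∑ f : B → ZMod 2, ((zmodTwoSign (f a) + ∑ b ∈ s, zmodTwoSign (f b)) ^ 4 +
        (-zmodTwoSign (f a) + ∑ b ∈ s, zmodTwoSign (f b)) ^ 4) =
        ∑ f : B → ZMod 2, (2 * (∑ b ∈ s, zmodTwoSign (f b)) ^ 4 +
          12 * (∑ b ∈ s, zmodTwoSign (f b)) ^ 2 + 2) :=
      sum_congr rfl fun f _ => by
        linear_combination (2 * zmodTwoSign (f a) ^ 2 + 2 +
          12 * (∑ b ∈ s, zmodTwoSign (f b)) ^ 2) * zmodTwoSign_sq (f a)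
    rw [sum_add_distrib, ← sum_add_zmodTwoSign_pow ha, sum_add_distrib, sum_add_distrib,
      ← mul_sum, ← mul_sum, ih, sum_zmodTwoSign_pow_two] at key
    simp at key
    push_cast
    linarith

end SignSums

/-- For `|B| = 2^k` and any `φ : B → ℤ/2`, the average over all
`f : B → ℤ/2` of the fourth power of
`c(f) = 2^{−(n+k)/2}·Σ_b (−1)^{f(b)+φ(b)}` equals `(3·2^{2k} − 2^{k+1})·2^{−2(n+k)}`,
which is strictly less than `3·2^{−2n}`. -/
theorem stmt15 (n k : ℕ) (hk : 1 ≤ k) (hkn : k < n)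
    (B : Type) [Fintype B] [DecidableEq B] (hB : Fintype.card B = 2 ^ k)
    (φ : B → ZMod 2) :
    (1 / 2 ^ (Fintype.card B) : ℝ) *
        ∑ f : B → ZMod 2,
          (((Real.sqrt 2) ^ (n + k))⁻¹ *
            ∑ b : B, (if f b + φ b = 0 then (1 : ℝ) else -1)) ^ 4 =
      (3 * 2 ^ (2 * k) - 2 ^ (k + 1)) * ((2 : ℝ) ^ (2 * (n + k)))⁻¹ ∧
    (3 * 2 ^ (2 * k) - 2 ^ (k + 1) : ℝ) * ((2 : ℝ) ^ (2 * (n + k)))⁻¹ <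
      3 * ((2 : ℝ) ^ (2 * n))⁻¹ := by
  have hsqrt : (((Real.sqrt 2) ^ (n + k))⁻¹) ^ 4 = ((2 : ℝ) ^ (2 * (n + k)))⁻¹ := by
    have h4 : Real.sqrt 2 ^ 4 = 2 ^ 2 := by
      rw [show 4 = 2 * 2 from rfl, pow_mul, Real.sq_sqrt zero_le_two]
    rw [inv_pow, ← pow_mul, mul_comm (n + k) 4, pow_mul, h4, ← pow_mul]
  have hsum : ∑ f : B → ZMod 2, (∑ b : B, (if f b + φ b = 0 then (1 : ℝ) else -1)) ^ 4 =
      (3 * 2 ^ (2 * k) - 2 ^ (k + 1)) * 2 ^ Fintype.card B := by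
    have h := sum_zmodTwoSign_pow_four (univ : Finset B)
    rw [← Equiv.sum_comp (Equiv.addRight φ), card_univ] at h
    refine h.trans ?_
    rw [hB]
    push_cast
    ring
  constructor
  · simp only [mul_pow _ _ 4]
    rw [← mul_sum, hsqrt, hsum]
    field_simp
  · have hpos : (0 : ℝ) < 2 ^ (k + 1) := by positivity
    calc (3 * 2 ^ (2 * k) - 2 ^ (k + 1) : ℝ) * ((2 : ℝ) ^ (2 * (n + k)))⁻¹
        < 3 * 2 ^ (2 * k) * ((2 : ℝ) ^ (2 * (n + k)))⁻¹ := by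
          gcongr
          linarith
      _ = 3 * ((2 : ℝ) ^ (2 * n))⁻¹ := by
          rw [mul_add, pow_add]
          field_simp
end

section
/- Let n > k ≥ 1 be natural numbers, B = {0,1}^k, A = {0,1}^{n−k}, V = {0,1}^n, and fix a ∈ A. For a bijection p : B × A → V and a function f : B × A → ℤ/2ℤ, define for each x ∈ V the real amplitude c_x = 2^{−(n+k)/2}·Σ_{b∈B} (−1)^{f(b,a) + x·p(b,a)}, where x·y denotes the inner product Σ_i x_i y_i mod 2 of n-bit strings (so that Σ_{x∈V} c_x² = 1; these are the amplitudes of the state H^{⊗n}|ψ_{p,f,a}⟩ with |ψ_{p,f,a}⟩ = 2^{−k/2} Σ_b (−1)^{f(b,a)}|p(b,a)⟩). Then for every real ε > 0, with probability greater than 1 − 3·2^{−εn} over a uniformly random bijection p and an independent uniformly random function f, the Shannon entropy −Σ_{x∈V} c_x²·log₂(c_x²) is at least (1−ε)·n/2 (with the convention 0·log 0 = 0). -/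
open Finset

/-- The amplitude `c_x = 2^{−(n+k)/2}·Σ_b (−1)^{f(b,a) + x·p(b,a)}` of the
Hadamard-transformed random subset-phase state. -/
noncomputable def subsetAmp (n k : ℕ)
    (p : ((Fin k → ZMod 2) × (Fin (n - k) → ZMod 2)) ≃ (Fin n → ZMod 2))
    (f : ((Fin k → ZMod 2) × (Fin (n - k) → ZMod 2)) → ZMod 2)
    (a : Fin (n - k) → ZMod 2) (x : Fin n → ZMod 2) : ℝ :=
  ((Real.sqrt 2) ^ (n + k))⁻¹ *
    ∑ b : Fin k → ZMod 2,
      (if f (b, a) + ∑ i : Fin n, x i * (p (b, a)) i = 0 then (1 : ℝ) else -1)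

/-- The sign `(-1)^z` of a bit `z`. -/
def bitSign (z : ZMod 2) : ℝ := if z = 0 then 1 else -1

lemma bitSign_zero : bitSign 0 = 1 := by simp [bitSign]

lemma bitSign_add_one (z : ZMod 2) : bitSign (z + 1) = -bitSign z := by
  have h : z = 0 ∨ z = 1 := by revert z; decide
  rcases h with rfl | rfl <;> simp [bitSign, CharTwo.add_self_eq_zero]

lemma bitSign_add (y z : ZMod 2) : bitSign (y + z) = bitSign y * bitSign z := by
  have h : z = 0 ∨ z = 1 := by revert z; decide
  rcases h with rfl | rfl
  · simp [bitSign_zero]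
  · rw [bitSign_add_one]
    simp [bitSign]

lemma bitSign_sq (z : ZMod 2) : bitSign z ^ 2 = 1 := by
  unfold bitSign; split_ifs <;> norm_num

/-- A function on a finite additive group that some translation negates has sum zero. -/
lemma sum_eq_zero_of_translate_neg {G : Type*} [AddGroup G] [Fintype G] (F : G → ℝ) (g : G)
    (h : ∀ x, F (x + g) = -F x) : ∑ x, F x = 0 := by
  have h1 : ∑ x, F (x + g) = ∑ x, F x := Equiv.sum_comp (Equiv.addRight g) F
  simp only [h, Finset.sum_neg_distrib] at h1
  linarith

section Moments

variable {ι : Type*} [DecidableEq ι]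

lemma signSum_translate (w : ι → ZMod 2) {s : Finset ι} {j : ι} (hj : j ∉ s) (f : ι → ZMod 2) :
    ∑ i ∈ s, bitSign ((f + Pi.single j 1 : ι → ZMod 2) i + w i) = ∑ i ∈ s, bitSign (f i + w i) := by
  refine Finset.sum_congr rfl fun i hi => ?_
  have hij : i ≠ j := fun h => hj (h ▸ hi)
  simp [hij]

lemma bitSign_translate (w : ι → ZMod 2) (j : ι) (f : ι → ZMod 2) :
    bitSign ((f + Pi.single j 1 : ι → ZMod 2) j + w j) = -bitSign (f j + w j) := by
  rw [← bitSign_add_one]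
  congr 1
  simp only [Pi.add_apply, Pi.single_eq_same]
  ring

variable [Fintype ι]

lemma sum_signSum_sq (w : ι → ZMod 2) (s : Finset ι) :
    ∑ f : ι → ZMod 2, (∑ i ∈ s, bitSign (f i + w i)) ^ 2
      = s.card * Fintype.card (ι → ZMod 2) := by
  induction s using Finset.induction_on with
  | empty => simp
  | insert j s hj ih =>
    have h1 : ∑ f : ι → ZMod 2,
        bitSign (f j + w j) * ∑ i ∈ s, bitSign (f i + w i) = 0 :=
      sum_eq_zero_of_translate_neg _ (Pi.single j 1) fun f => by
        rw [signSum_translate w hj, bitSign_translate]; ring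
    have h2 : ∀ f : ι → ZMod 2, (∑ i ∈ insert j s, bitSign (f i + w i)) ^ 2
        = 1 + 2 * (bitSign (f j + w j) * ∑ i ∈ s, bitSign (f i + w i))
          + (∑ i ∈ s, bitSign (f i + w i)) ^ 2 := fun f => by
      rw [Finset.sum_insert hj, add_sq, bitSign_sq]; ring
    simp only [h2, Finset.sum_add_distrib, ← Finset.mul_sum, h1, ih,
      Finset.card_insert_of_notMem hj]
    simp only [Finset.sum_const, Finset.card_univ, nsmul_eq_mul]
    push_cast
    ring

lemma sum_signSum_pow_four_le (w : ι → ZMod 2) (s : Finset ι) :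
    ∑ f : ι → ZMod 2, (∑ i ∈ s, bitSign (f i + w i)) ^ 4
      ≤ 3 * (s.card : ℝ) ^ 2 * Fintype.card (ι → ZMod 2) := by
  induction s using Finset.induction_on with
  | empty => simp
  | insert j s hj ih =>
    have h1 : ∑ f : ι → ZMod 2, (bitSign (f j + w j) *
        (4 * (∑ i ∈ s, bitSign (f i + w i)) ^ 3 + 4 * ∑ i ∈ s, bitSign (f i + w i))) = 0 :=
      sum_eq_zero_of_translate_neg _ (Pi.single j 1) fun f => by
        rw [signSum_translate w hj, bitSign_translate]; ring
    have h2 : ∀ f : ι → ZMod 2, (∑ i ∈ insert j s, bitSign (f i + w i)) ^ 4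
        = 1 + (bitSign (f j + w j) *
            (4 * (∑ i ∈ s, bitSign (f i + w i)) ^ 3 + 4 * ∑ i ∈ s, bitSign (f i + w i)))
          + 6 * (∑ i ∈ s, bitSign (f i + w i)) ^ 2
          + (∑ i ∈ s, bitSign (f i + w i)) ^ 4 := fun f => by
      rw [Finset.sum_insert hj]
      generalize ∑ i ∈ s, bitSign (f i + w i) = S
      have h := bitSign_sq (f j + w j)
      generalize bitSign (f j + w j) = e at h
      linear_combination (e ^ 2 + 1 + 4 * e * S + 6 * S ^ 2) * h
    simp only [h2, Finset.sum_add_distrib, ← Finset.mul_sum, h1, sum_signSum_sq,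
      Finset.card_insert_of_notMem hj]
    simp only [Finset.sum_const, Finset.card_univ, nsmul_eq_mul]
    have hN : (0 : ℝ) ≤ Fintype.card (ι → ZMod 2) := Nat.cast_nonneg _
    push_cast
    nlinarith

end Moments

lemma sum_bitSign_inner_eq_zero {n : ℕ} {y : Fin n → ZMod 2} (hy : y ≠ 0) :
    ∑ x : Fin n → ZMod 2, bitSign (∑ i, x i * y i) = 0 := by
  obtain ⟨j, hj⟩ := Function.ne_iff.mp hy
  have hj1 : y j = 1 := by
    have : ∀ z : ZMod 2, z ≠ 0 → z = 1 := by decide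
    exact this _ hj
  refine sum_eq_zero_of_translate_neg _ (Pi.single j 1) fun x => ?_
  rw [← bitSign_add_one]
  congr 1
  simp [add_mul, Finset.sum_add_distrib, Pi.single_apply, hj1]

lemma sum_bitSign_inner_mul {n : ℕ} (y z : Fin n → ZMod 2) :
    ∑ x : Fin n → ZMod 2, bitSign (∑ i, x i * y i) * bitSign (∑ i, x i * z i)
      = if y = z then (2 : ℝ) ^ n else 0 := by
  have h : ∀ x : Fin n → ZMod 2, bitSign (∑ i, x i * y i) * bitSign (∑ i, x i * z i)
      = bitSign (∑ i, x i * (y - z) i) := fun x => by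
    rw [← bitSign_add, ← Finset.sum_add_distrib]
    simp [mul_add, CharTwo.sub_eq_add]
  simp only [h]
  split_ifs with hyz
  · simp [hyz, bitSign_zero]
  · exact sum_bitSign_inner_eq_zero (sub_ne_zero.mpr hyz)

lemma subsetAmp_eq (n k : ℕ)
    (p : ((Fin k → ZMod 2) × (Fin (n - k) → ZMod 2)) ≃ (Fin n → ZMod 2))
    (f : ((Fin k → ZMod 2) × (Fin (n - k) → ZMod 2)) → ZMod 2)
    (a : Fin (n - k) → ZMod 2) (x : Fin n → ZMod 2) :
    subsetAmp n k p f a x = ((Real.sqrt 2) ^ (n + k))⁻¹ *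
      ∑ b : Fin k → ZMod 2, bitSign (f (b, a) + ∑ i, x i * p (b, a) i) := rfl

lemma sqrt_two_pow_sq (m : ℕ) : ((Real.sqrt 2) ^ m) ^ 2 = 2 ^ m := by
  rw [pow_right_comm, Real.sq_sqrt (by norm_num)]

lemma sum_subsetAmp_sq (n k : ℕ)
    (p : ((Fin k → ZMod 2) × (Fin (n - k) → ZMod 2)) ≃ (Fin n → ZMod 2))
    (f : ((Fin k → ZMod 2) × (Fin (n - k) → ZMod 2)) → ZMod 2)
    (a : Fin (n - k) → ZMod 2) :
    ∑ x, subsetAmp n k p f a x ^ 2 = 1 := by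
  have h : ∑ x : Fin n → ZMod 2,
      (∑ b : Fin k → ZMod 2, bitSign (f (b, a) + ∑ i, x i * p (b, a) i)) ^ 2
      = 2 ^ (n + k) := by
    calc _ = ∑ b : Fin k → ZMod 2, ∑ b' : Fin k → ZMod 2,
          bitSign (f (b, a)) * bitSign (f (b', a)) *
          ∑ x : Fin n → ZMod 2,
            bitSign (∑ i, x i * p (b, a) i) * bitSign (∑ i, x i * p (b', a) i) := by
          simp only [sq, Finset.sum_mul_sum]
          simp only [Finset.mul_sum, bitSign_add]
          rw [Finset.sum_comm]
          refine Finset.sum_congr rfl fun b _ => ?_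
          rw [Finset.sum_comm]
          refine Finset.sum_congr rfl fun b' _ => Finset.sum_congr rfl fun x _ => ?_
          ring
      _ = ∑ b : Fin k → ZMod 2, bitSign (f (b, a)) ^ 2 * 2 ^ n := by
          refine Finset.sum_congr rfl fun b _ => ?_
          simp only [sum_bitSign_inner_mul, p.injective.eq_iff, Prod.mk.injEq, and_true,
            mul_ite, mul_zero, Finset.sum_ite_eq, Finset.mem_univ, if_true]
          ring
      _ = 2 ^ (n + k) := by
          simp [bitSign_sq, pow_add, mul_comm]
  simp only [subsetAmp_eq, mul_pow, ← Finset.mul_sum, h, inv_pow, sqrt_two_pow_sq]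
  exact inv_mul_cancel₀ (by positivity)

lemma sum_sum_subsetAmp_pow_four_le (n k : ℕ)
    (p : ((Fin k → ZMod 2) × (Fin (n - k) → ZMod 2)) ≃ (Fin n → ZMod 2))
    (a : Fin (n - k) → ZMod 2) :
    ∑ f : ((Fin k → ZMod 2) × (Fin (n - k) → ZMod 2)) → ZMod 2,
        ∑ x, (subsetAmp n k p f a x ^ 2) ^ 2
      ≤ 3 * (2 ^ n)⁻¹ *
        Fintype.card (((Fin k → ZMod 2) × (Fin (n - k) → ZMod 2)) → ZMod 2) := by
  set N : ℝ :=
    ((Fintype.card (((Fin k → ZMod 2) × (Fin (n - k) → ZMod 2)) → ZMod 2) : ℕ) : ℝ) with hN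
  have h : ∀ x : Fin n → ZMod 2,
      ∑ f : ((Fin k → ZMod 2) × (Fin (n - k) → ZMod 2)) → ZMod 2,
        (∑ b : Fin k → ZMod 2, bitSign (f (b, a) + ∑ i, x i * p (b, a) i)) ^ 4
      ≤ 3 * (2 ^ k) ^ 2 * N := fun x => by
    have := sum_signSum_pow_four_le (fun q => ∑ i, x i * p q i)
      (Finset.univ.map ⟨fun b : Fin k → ZMod 2 => (b, a), Prod.mk_left_injective a⟩)
    simpa [hN] using this
  rw [Finset.sum_comm]
  calc _ = ∑ x : Fin n → ZMod 2, ((2 ^ (n + k))⁻¹ ^ 2 *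
        ∑ f : ((Fin k → ZMod 2) × (Fin (n - k) → ZMod 2)) → ZMod 2,
        (∑ b : Fin k → ZMod 2, bitSign (f (b, a) + ∑ i, x i * p (b, a) i)) ^ 4) := by
        refine Finset.sum_congr rfl fun x _ => ?_
        rw [Finset.mul_sum]
        refine Finset.sum_congr rfl fun f _ => ?_
        rw [subsetAmp_eq, mul_pow, inv_pow, sqrt_two_pow_sq]
        ring
    _ ≤ ∑ x : Fin n → ZMod 2, ((2 ^ (n + k))⁻¹ ^ 2 * (3 * (2 ^ k) ^ 2 * N)) := by
        gcongr with x
        exact h x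
    _ = 3 * (2 ^ n)⁻¹ * N := by
        simp only [Finset.sum_const, Finset.card_univ, Fintype.card_fun, ZMod.card,
          Fintype.card_fin, nsmul_eq_mul, pow_add]
        push_cast
        field_simp

/-- Shannon entropy is bounded below by collision entropy. -/
lemma neg_logb_le_entropy {α : Type*} [Fintype α] (q : α → ℝ) (hq : ∀ x, 0 ≤ q x)
    (hq1 : ∑ x, q x = 1) {T : ℝ} (hT : 0 < T) (h : ∑ x, q x ^ 2 ≤ T) :
    -Real.logb 2 T ≤ -∑ x, q x * Real.logb 2 (q x) := by
  have hl : 0 < Real.log 2 := Real.log_pos (by norm_num)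
  have hx : ∀ x, q x * Real.log (q x) ≤ q x * Real.log T + (q x ^ 2 / T - q x) := fun x => by
    rcases (hq x).eq_or_lt with h0 | h0
    · simp [← h0]
    · have h1 := Real.log_le_sub_one_of_pos (div_pos h0 hT)
      rw [Real.log_div h0.ne' hT.ne'] at h1
      have h2 := mul_le_mul_of_nonneg_left h1 h0.le
      have h3 : q x * (q x / T - 1) = q x ^ 2 / T - q x := by ring
      linarith
  have hs : ∑ x, q x * Real.log (q x) ≤ Real.log T := by
    refine (Finset.sum_le_sum fun x _ => hx x).trans ?_
    rw [Finset.sum_add_distrib, Finset.sum_sub_distrib, ← Finset.sum_mul, ← Finset.sum_div, hq1]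
    have := (div_le_one hT).mpr h
    linarith
  simp only [Real.logb, ← mul_div_assoc, ← Finset.sum_div]
  gcongr

open Classical in
/-- Markov's inequality for counting, in terms of the complementary event. -/
lemma one_sub_le_card_filter_div {Ω : Type*} [Fintype Ω] [Nonempty Ω] (P : Ω → Prop)
    (X : Ω → ℝ) (hX : ∀ ω, 0 ≤ X ω) {T C : ℝ} (hT : 0 < T) (hP : ∀ ω, X ω ≤ T → P ω)
    (hC : ∑ ω, X ω ≤ C * Fintype.card Ω) :
    1 - C / T ≤ ((Finset.univ.filter P).card : ℝ) / Fintype.card Ω := by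
  have hN : (0 : ℝ) < Fintype.card Ω := Nat.cast_pos.mpr Fintype.card_pos
  have h1 : ((Finset.univ.filter P).card : ℝ) + (Finset.univ.filter fun ω => ¬P ω).card
      = Fintype.card Ω := by
    exact_mod_cast Finset.card_filter_add_card_filter_not (s := Finset.univ) P
  have h2 : ((Finset.univ.filter fun ω => ¬P ω).card : ℝ) * T ≤ C * Fintype.card Ω := by
    refine le_trans ?_ hC
    rw [← nsmul_eq_mul]
    refine (Finset.card_nsmul_le_sum _ X T fun ω hω => ?_).trans
      (Finset.sum_le_sum_of_subset_of_nonneg (Finset.subset_univ _) fun ω _ _ => hX ω)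
    by_contra hlt
    exact (Finset.mem_filter.mp hω).2 (hP ω (not_le.mp hlt).le)
  rw [le_div_iff₀ hN]
  have h3 := (le_div_iff₀ hT).mpr h2
  have h4 : (1 - C / T) * Fintype.card Ω
      = Fintype.card Ω - C * Fintype.card Ω / T := by ring
  linarith

/- **Statement 16.** With probability greater than `1 − 3·2^{−εn}` over a uniformly
random bijection `p` and an independent uniformly random sign function `f`, the
Shannon entropy `−Σ_x c_x²·log₂(c_x²)` of the amplitudes of `H^{⊗n}|ψ_{p,f,a}⟩`
is at least `(1−ε)·n/2`. -/
open Classical in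
theorem stmt16 (n k : ℕ) (hk : 1 ≤ k) (hkn : k < n)
    (a : Fin (n - k) → ZMod 2) (ε : ℝ) (hε : 0 < ε) :
    ((Finset.univ.filter fun pf :
        (((Fin k → ZMod 2) × (Fin (n - k) → ZMod 2)) ≃ (Fin n → ZMod 2)) ×
          (((Fin k → ZMod 2) × (Fin (n - k) → ZMod 2)) → ZMod 2) =>
        (1 - ε) * n / 2 ≤
          -∑ x : Fin n → ZMod 2,
            (subsetAmp n k pf.1 pf.2 a x) ^ 2 *
              Real.logb 2 ((subsetAmp n k pf.1 pf.2 a x) ^ 2)).card : ℝ) /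
      ((Fintype.card
          (((Fin k → ZMod 2) × (Fin (n - k) → ZMod 2)) ≃ (Fin n → ZMod 2)) : ℝ) *
        2 ^ (Fintype.card ((Fin k → ZMod 2) × (Fin (n - k) → ZMod 2)))) >
    1 - 3 * (2 : ℝ) ^ (-(ε * n)) := by
  set I := (Fin k → ZMod 2) × (Fin (n - k) → ZMod 2)
  have hn : (0 : ℝ) < n := Nat.cast_pos.mpr (by omega)
  have hcardI : Fintype.card I = Fintype.card (Fin n → ZMod 2) := by
    simp only [I, Fintype.card_prod, Fintype.card_fun, ZMod.card, Fintype.card_fin, ← pow_add]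
    congr 1
    omega
  have : Nonempty (I ≃ (Fin n → ZMod 2)) := ⟨Fintype.equivOfCardEq hcardI⟩
  have hcard : (Fintype.card (I ≃ (Fin n → ZMod 2)) : ℝ) * 2 ^ Fintype.card I
      = Fintype.card ((I ≃ (Fin n → ZMod 2)) × (I → ZMod 2)) := by
    simp [Fintype.card_prod]
  rw [hcard]
  set T : ℝ := 2 ^ (-((1 - ε) * n / 2)) with hTdef
  have hT : 0 < T := by positivity
  have hlogT : -Real.logb 2 T = (1 - ε) * n / 2 := by
    rw [hTdef, Real.logb_rpow (by norm_num) (by norm_num), neg_neg]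
  have hgood : ∀ pf : (I ≃ (Fin n → ZMod 2)) × (I → ZMod 2),
      ∑ x, (subsetAmp n k pf.1 pf.2 a x ^ 2) ^ 2 ≤ T →
      (1 - ε) * n / 2 ≤ -∑ x : Fin n → ZMod 2, (subsetAmp n k pf.1 pf.2 a x) ^ 2 *
        Real.logb 2 ((subsetAmp n k pf.1 pf.2 a x) ^ 2) := fun pf h => by
    rw [← hlogT]
    exact neg_logb_le_entropy _ (fun x => sq_nonneg _) (sum_subsetAmp_sq n k pf.1 pf.2 a) hT h
  rcases lt_or_ge ε 1 with hε1 | hε1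
  · have hmarkov := one_sub_le_card_filter_div _
      (fun pf : (I ≃ (Fin n → ZMod 2)) × (I → ZMod 2) =>
        ∑ x, (subsetAmp n k pf.1 pf.2 a x ^ 2) ^ 2)
      (fun pf => Finset.sum_nonneg fun x _ => sq_nonneg _) (C := 3 * (2 ^ n)⁻¹) hT hgood (by
        rw [Fintype.sum_prod_type]
        refine (Finset.sum_le_sum fun p _ =>
          sum_sum_subsetAmp_pow_four_le n k p a).trans (le_of_eq ?_)
        rw [Finset.sum_const, Finset.card_univ, nsmul_eq_mul, Fintype.card_prod]
        push_cast
        ring)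
    refine lt_of_lt_of_le ?_ hmarkov
    have hlt : ((2 : ℝ) ^ n)⁻¹ / T < 2 ^ (-(ε * n)) := by
      rw [hTdef, ← Real.rpow_natCast, ← Real.rpow_neg (by norm_num),
        ← Real.rpow_sub (by norm_num)]
      apply Real.rpow_lt_rpow_of_exponent_lt (by norm_num)
      nlinarith
    rw [mul_div_assoc]
    linarith
  · have hT1 : 1 ≤ T := Real.one_le_rpow (by norm_num) (by nlinarith)
    rw [Finset.filter_true_of_mem, Finset.card_univ, div_self]
    · have : (0 : ℝ) < 2 ^ (-(ε * n)) := by positivity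
      linarith
    · exact Nat.cast_ne_zero.mpr Fintype.card_ne_zero
    · refine fun pf _ => hgood pf (le_trans ?_ hT1)
      have hsum := sum_subsetAmp_sq n k pf.1 pf.2 a
      refine le_trans (Finset.sum_le_sum fun x _ => ?_) hsum.le
      have hle : subsetAmp n k pf.1 pf.2 a x ^ 2 ≤ 1 := hsum ▸
        Finset.single_le_sum (f := fun x => subsetAmp n k pf.1 pf.2 a x ^ 2)
          (fun y _ => sq_nonneg _) (Finset.mem_univ x)
      nlinarith [sq_nonneg (subsetAmp n k pf.1 pf.2 a x)]
end
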